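/- arXiv:2104.09657 — 3 statements merged into one kernel-verified Lean document; each statement's English description precedes it below -/
import Mathlib

section
/- Let K ⊆ L be fields, let D be a subring of K, and set T = K+XL[X] and R = D+XL[X]. Then R is a finite factorization domain (FFD) if and only if T is an FFD, D is a field, and the quotient group K*/D* of the multiplicative group of K by the subgroup of units of D is finite. -/
open Polynomial

/-- The composite `A + X B[X]`: the subring of the polynomial ring `B[X]` consisting of
polynomials whose constant coefficient lies in the subring `A`. -/
def composite {B : Type*} [CommRing B] (A : Subring B) : Subring (Polynomial B) where
  carrier := {f | f.coeff 0 ∈ A}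
  mul_mem' := fun hf hg => by simpa [Polynomial.mul_coeff_zero] using A.mul_mem hf hg
  one_mem' := by simpa using A.one_mem
  add_mem' := fun hf hg => by simpa using A.add_mem hf hg
  zero_mem' := by simpa using A.zero_mem
  neg_mem' := fun hf => by simpa using A.neg_mem hf

/-- An integral domain is atomic if every nonzero nonunit is a finite product of
irreducible elements. -/
def IsAtomicDomain (R : Type*) [CommRing R] : Prop :=
  ∀ a : R, a ≠ 0 → ¬IsUnit a →
    ∃ s : Multiset R, (∀ x ∈ s, Irreducible x) ∧ s.prod = a

/-- A finite factorization domain (FFD): every nonzero nonunit has only finitely many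
pairwise nonassociate divisors. -/
def IsFFD (R : Type*) [CommRing R] : Prop :=
  ∀ a : R, a ≠ 0 → ¬IsUnit a → ∃ s : Finset R,
    ∀ d : R, d ∣ a → ∃ d' ∈ s, Associated d d'

/-- The inclusion of a subring `D` of a field `L` into a subfield `K` containing it. -/
def subringToSubfield {L : Type*} [Field L] (K : Subfield L) (D : Subring L)
    (hDK : ∀ x, x ∈ D → x ∈ K) : D →+* K where
  toFun d := ⟨(d : L), hDK _ d.2⟩
  map_one' := rfl
  map_mul' _ _ := rfl
  map_zero' := rfl
  map_add' _ _ := rfl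

/-- The image of the units of `A` in the unit group of `L`. -/
def unitImage {L : Type*} [Field L] (A : Subring L) : Subgroup Lˣ :=
  (Units.map A.subtype.toMonoidHom).range

theorem mem_unitImage {L : Type*} [Field L] (A : Subring L) (c : Lˣ) :
    c ∈ unitImage A ↔ (c : L) ∈ A ∧ ((c⁻¹ : Lˣ) : L) ∈ A := by
  constructor
  · rintro ⟨u, rfl⟩
    exact ⟨u.1.2, u⁻¹.1.2⟩
  · rintro ⟨h1, h2⟩
    refine ⟨⟨⟨c, h1⟩, ⟨_, h2⟩, ?_, ?_⟩, ?_⟩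
    · ext; simp
    · ext; simp
    · ext; rfl

theorem ffd_finiteIndex {L : Type*} [Field L] (A : Subring L)
    (h : IsFFD (composite A)) : (unitImage A).FiniteIndex := by
  have hX : ∀ c : L, (C c * X : L[X]) ∈ composite A := fun c => by
    change (C c * X : L[X]).coeff 0 ∈ A
    simp [A.zero_mem]
  let m : L → composite A := fun c => ⟨C c * X, hX c⟩
  obtain ⟨s, hs⟩ := h (m 1 * m 1) (by
      intro h0
      have := congrArg Subtype.val h0
      simp [m] at this) (by
      intro hu
      have := hu.map (composite A).subtype
      have h2 : IsUnit (X * X : L[X]) := by simpa [m] using this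
      exact not_isUnit_X (isUnit_of_mul_isUnit_left h2))
  have hdvd : ∀ c : Lˣ, ∃ d' ∈ s, Associated (m c) d' := fun c => by
    apply hs
    refine ⟨m ((c⁻¹ : Lˣ) : L), ?_⟩
    apply Subtype.ext
    change C 1 * X * (C 1 * X) = (C (c : L) * X) * (C (((c⁻¹ : Lˣ) : L)) * X)
    have : C (c : L) * C (((c⁻¹ : Lˣ) : L)) = 1 := by rw [← C_mul]; simp
    simp only [C_1, one_mul]
    linear_combination (-X * X) * this
  choose g hg hga using hdvd
  have key : ∀ c c' : Lˣ, g c = g c' → c⁻¹ * c' ∈ unitImage A := by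
    intro c c' hcc
    obtain ⟨u, hu⟩ := (hga c).trans (hcc ▸ (hga c').symm)
    have h1 : (c : L) * (u.1.1).coeff 0 = c' := by
      have := congrArg (fun z : composite A => z.1.coeff 1) hu
      change ((C (c : L) * X) * u.1.1).coeff 1 = (C (c' : L) * X).coeff 1 at this
      rw [mul_assoc, coeff_C_mul, coeff_C_mul, coeff_X_mul u.1.1 0] at this
      simpa using this
    have h2 : (u.1.1).coeff 0 * (u.2.1).coeff 0 = 1 := by
      have := congrArg (fun z : composite A => z.1.coeff 0) u.3
      change (u.1.1 * u.2.1).coeff 0 = (1 : L[X]).coeff 0 at this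
      simpa [mul_coeff_zero] using this
    have h3 : ((c⁻¹ * c' : Lˣ) : L) = u.1.1.coeff 0 := by
      rw [Units.val_mul, ← h1]; simp
    rw [mem_unitImage]
    refine ⟨h3 ▸ u.1.2, ?_⟩
    rw [Units.val_inv_eq_inv_val, h3, inv_eq_of_mul_eq_one_right h2]
    exact u.2.2
  have : Finite (Lˣ ⧸ unitImage A) := by
    refine Finite.of_injective
      (fun q : Lˣ ⧸ unitImage A => (⟨g q.out, hg _⟩ : {x // x ∈ s})) ?_
    intro q q' hq
    have := key _ _ (congrArg Subtype.val hq)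
    rw [← QuotientGroup.eq] at this
    simpa using this
  exact Subgroup.finiteIndex_of_finite_quotient

theorem finiteIndex_ffd {L : Type*} [Field L] (A : Subring L)
    (h : (unitImage A).FiniteIndex) : IsFFD (composite A) := by
  classical
  intro a ha _
  have ha' : (a : L[X]) ≠ 0 := fun h0 => ha (Subtype.ext h0)
  have : Finite (Lˣ ⧸ unitImage A) := inferInstance
  have hfin : Finite {g : L[X] // g.Monic ∧ g ∣ (a : L[X])} :=
    (fintypeSubtypeMonicDvd (a : L[X]) ha').finite
  have hd0 : ∀ d : {d : composite A // d ∣ a}, (d.1 : L[X]) ≠ 0 := fun d h0 => by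
    obtain ⟨e, he⟩ := d.2
    apply ha'
    rw [he]
    change (d.1 : L[X]) * e = 0
    rw [h0, zero_mul]
  have hl : ∀ d : {d : composite A // d ∣ a}, (d.1 : L[X]).leadingCoeff ≠ 0 := fun d =>
    leadingCoeff_ne_zero.2 (hd0 d)
  let φ : {d : composite A // d ∣ a} →
      {g : L[X] // g.Monic ∧ g ∣ (a : L[X])} × (Lˣ ⧸ unitImage A) := fun d =>
    (⟨(d.1 : L[X]) * C (d.1 : L[X]).leadingCoeff⁻¹, monic_mul_leadingCoeff_inv (hd0 d), by
      have h1 : (d.1 : L[X]) ∣ a := map_dvd (composite A).subtype d.2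
      refine (IsUnit.mul_right_dvd ?_).2 h1
      exact isUnit_C.2 (isUnit_iff_ne_zero.2 (inv_ne_zero (hl d)))⟩,
      QuotientGroup.mk (Units.mk0 _ (hl d)))
  have hφ : ∀ d e, φ d = φ e → Associated d.1 e.1 := by
    intro d e hde
    have h1 : (d.1 : L[X]) * C (d.1 : L[X]).leadingCoeff⁻¹
        = (e.1 : L[X]) * C (e.1 : L[X]).leadingCoeff⁻¹ :=
      congrArg (fun z => z.1.1) hde
    have h2 : (QuotientGroup.mk (Units.mk0 _ (hl d)) : Lˣ ⧸ unitImage A)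
      = QuotientGroup.mk (Units.mk0 _ (hl e)) := congrArg (fun z => z.2) hde
    rw [QuotientGroup.eq] at h2
    obtain ⟨v, hv⟩ := h2
    let ι : A →+* composite A :=
      { toFun := fun x => ⟨C (x : L), by change (C (x : L)).coeff 0 ∈ A; simp⟩
        map_one' := by ext1; simp
        map_mul' := fun x y => by ext1; simp
        map_zero' := by ext1; simp
        map_add' := fun x y => by ext1; simp }
    refine ⟨Units.map ι.toMonoidHom v, ?_⟩
    apply Subtype.ext
    change (d.1 : L[X]) * C ((v : A) : L) = e.1
    have hv' : ((v : A) : L) = (d.1 : L[X]).leadingCoeff⁻¹ * (e.1 : L[X]).leadingCoeff := by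
      have := congrArg Units.val hv
      simpa using this
    rw [hv', C_mul, ← mul_assoc, h1, mul_assoc, ← C_mul, inv_mul_cancel₀ (hl e), C_1, mul_one]
  have hr : (Set.range φ).Finite := Set.toFinite _
  have : Fintype (Set.range φ) := hr.fintype
  refine ⟨Finset.univ.image (fun y : Set.range φ => (y.2.choose).1), fun d hd => ?_⟩
  refine ⟨_, Finset.mem_image_of_mem _ (Finset.mem_univ ⟨φ ⟨d, hd⟩, ⟨d, hd⟩, rfl⟩), ?_⟩
  apply hφ ⟨d, hd⟩
  exact (Exists.choose_spec (p := fun z => φ z = φ ⟨d, hd⟩) ⟨⟨d, hd⟩, rfl⟩).symm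

/-- for fields `K ⊆ L` and `D` a subring of `K`, with `T = K + XL[X]` and
`R = D + XL[X]`, the ring `R` is an FFD iff `T` is an FFD, `D` is a field, and `K⋆/D⋆`
is finite (where `D⋆` is the image of the units of `D` in `K⋆`). -/
theorem stmt8 {L : Type*} [Field L] (K : Subfield L) (D : Subring L)
    (hDK : ∀ x, x ∈ D → x ∈ K) :
    IsFFD (composite D) ↔
      IsFFD (composite K.toSubring) ∧ IsField D ∧
        Finite (Kˣ ⧸ (Units.map (subringToSubfield K D hDK).toMonoidHom).range) := by
  have e : ∀ A : Subring L, IsFFD (composite A) ↔ (unitImage A).index ≠ 0 := fun A =>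
    ⟨fun h => (ffd_finiteIndex A h).index_ne_zero, fun h => finiteIndex_ffd A ⟨h⟩⟩
  have hle : unitImage D ≤ unitImage K.toSubring := fun c hc => by
    rw [mem_unitImage] at hc ⊢
    exact ⟨hDK _ hc.1, hDK _ hc.2⟩
  have hN : (Units.map (subringToSubfield K D hDK).toMonoidHom).range
      = (unitImage D).comap (Units.map K.subtype.toMonoidHom) := by
    ext c
    rw [Subgroup.mem_comap]
    constructor
    · rintro ⟨u, rfl⟩
      exact ⟨u, by ext; rfl⟩
    · rintro ⟨u, hu⟩
      refine ⟨u, ?_⟩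
      ext
      exact congrArg Units.val hu
  have hK : (Units.map K.subtype.toMonoidHom).range = unitImage K.toSubring := rfl
  have hidx : (Units.map (subringToSubfield K D hDK).toMonoidHom).range.index
      = (unitImage D).relIndex (unitImage K.toSubring) := by
    rw [hN, Subgroup.index_comap, hK]
  have hq : Finite (Kˣ ⧸ (Units.map (subringToSubfield K D hDK).toMonoidHom).range) ↔
      (unitImage D).relIndex (unitImage K.toSubring) ≠ 0 := by
    rw [← hidx]
    exact ⟨fun h => Subgroup.finiteIndex_of_finite_quotient.index_ne_zero,
      fun h => by
        haveI : (Units.map (subringToSubfield K D hDK).toMonoidHom).range.FiniteIndex := ⟨h⟩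
        exact Subgroup.finite_quotient_of_finiteIndex⟩
  have hmul := Subgroup.relIndex_mul_index hle
  rw [e, e, hq, ← hmul]
  constructor
  · intro h
    refine ⟨right_ne_zero_of_mul h, ?_, left_ne_zero_of_mul h⟩
    rw [hmul] at h
    refine ⟨exists_pair_ne D, mul_comm, fun {d} hd => ?_⟩
    have hd' : (d : L) ≠ 0 := fun h0 => hd (Subtype.ext h0)
    obtain ⟨n, hn, -, hmem⟩ := Subgroup.exists_pow_mem_of_index_ne_zero h (Units.mk0 _ hd')
    obtain ⟨u, hu⟩ := hmem
    have hu' : (u : D) = d ^ n := by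
      ext
      simpa using congrArg Units.val hu
    have : IsUnit d := (isUnit_pow_iff hn.ne').1 (hu' ▸ u.isUnit)
    exact this.exists_right_inv
  · rintro ⟨h1, -, h2⟩
    exact mul_ne_zero h2 h1
end

section
/- For any integral domain D, the polynomial ring D[X] is an S-domain; that is, for every prime ideal P of D[X] of height 1, the extended ideal P·D[X][Y] generated by the image of P in the polynomial ring D[X][Y] has height 1. -/
open Polynomial

/-- The height of an ideal: the infimum, over prime ideals `P` containing `I`, of the
height of `P` in the poset of prime ideals (the supremum of lengths of chains of primes
descending from `P`). -/
noncomputable def idealHeight {R : Type*} [CommRing R] (I : Ideal R) : ℕ∞ :=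
  ⨅ P ∈ {P : PrimeSpectrum R | I ≤ P.asIdeal}, Order.height P

/-- An S-domain: for every prime ideal `P` of height 1, the extended ideal `P·R[X]`
(generated by the image of `P` under the constant-coefficient embedding `R → R[X]`)
has height 1 in `R[X]`. -/
def IsSDomain (R : Type*) [CommRing R] : Prop :=
  ∀ P : Ideal R, P.IsPrime → idealHeight P = 1 →
    idealHeight (P.map (Polynomial.C : R →+* Polynomial R)) = 1

theorem sd_exists_val {R L : Type*} [CommRing R] [Field L] (P : Ideal R) [P.IsPrime]
    (φ : R →+* L) (hφ : RingHom.ker φ ≤ P) :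
    ∃ (V : ValuationSubring L) (ψ : R →+* V), (∀ r, (ψ r : L) = φ r) ∧
      ∀ r, IsLocalRing.residue V (ψ r) = 0 ↔ r ∈ P := by
  have hu : ∀ y : P.primeCompl, IsUnit (φ y) := by
    intro y
    rw [isUnit_iff_ne_zero]
    intro h
    exact y.2 (hφ h)
  let f : Localization.AtPrime P →+* L := IsLocalization.lift (M := P.primeCompl) hu
  obtain ⟨V, h, hl⟩ := IsLocalRing.exists_factor_valuationRing f
  refine ⟨V, (f.codRestrict V.toSubring h).comp (algebraMap R _), ?_, ?_⟩
  · intro r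
    exact IsLocalization.lift_eq hu r
  · intro r
    rw [IsLocalRing.residue_eq_zero_iff, IsLocalRing.mem_maximalIdeal, mem_nonunits_iff]
    rw [← not_iff_not, not_not]
    refine Iff.trans ?_ (IsLocalization.AtPrime.isUnit_to_map_iff (Localization.AtPrime P) P r)
    exact ⟨fun h => hl.1 _ h, fun h => h.map (f.codRestrict V.toSubring _)⟩

theorem sd_core_aux {D σ L κ : Type*} [CommRing D] [IsDomain D] [Field L] [Field κ] (p : Ideal D)
    (H : ∀ u : FractionRing D, ∃ g : D[X], (∃ n, g.coeff n ∉ p) ∧ aeval u g = 0)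
    (Q : Ideal (MvPolynomial σ D))
    (hQ0 : ∀ d, MvPolynomial.C d ∈ Q → d = 0)
    (φ : MvPolynomial σ D →+* L) (hφ0 : ∀ r, φ r = 0 ↔ r ∈ Q)
    (V : ValuationSubring L) (ψ : MvPolynomial σ D →+* V) (hψ : ∀ r, (ψ r : L) = φ r)
    (ρ : V →+* κ)
    (hres : ∀ r, ρ (ψ r) = 0 ↔ r ∈ p.map (MvPolynomial.C : D →+* MvPolynomial σ D)) :
    Q = ⊥ := by
  classical
  let A : Subring κ := ((ρ.comp ψ).comp MvPolynomial.C).range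
  let q : D →+* A := ((ρ.comp ψ).comp MvPolynomial.C).rangeRestrict
  have hqs : Function.Surjective q := RingHom.rangeRestrict_surjective _
  have hq0 : ∀ d, q d = 0 ↔ d ∈ p := by
    intro d
    rw [Subtype.ext_iff]
    change ρ (ψ (MvPolynomial.C d)) = 0 ↔ _
    rw [hres, MvPolynomial.mem_map_C_iff]
    constructor
    · intro h; simpa using h 0
    · intro h m
      rw [MvPolynomial.coeff_C]; split_ifs
      · exact h
      · exact p.zero_mem
  let x : σ → κ := fun i => ρ (ψ (MvPolynomial.X i))
  have hind : AlgebraicIndependent A x := by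
    rw [algebraicIndependent_iff]
    intro g hg
    obtain ⟨g', rfl⟩ := MvPolynomial.map_surjective q hqs g
    have e : MvPolynomial.aeval x (MvPolynomial.map q g') = ρ (ψ g') := by
      have : ((MvPolynomial.aeval x : MvPolynomial σ A →ₐ[A] κ) : MvPolynomial σ A →+* κ).comp
          (MvPolynomial.map q) = ρ.comp ψ := by
        apply MvPolynomial.ringHom_ext
        · intro d
          simp; rfl
        · intro i; simp [x]
      exact congr($this g')
    rw [e, hres, MvPolynomial.mem_map_C_iff] at hg
    ext m
    rw [MvPolynomial.coeff_map, (hq0 _).2 (hg m)]; simp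
  let F := Subalgebra.algebraicClosure A κ
  have hind' : AlgebraicIndependent F x := hind.extendScalars F
  -- embedding of the fraction field
  have hinj : Function.Injective (φ.comp MvPolynomial.C) := by
    rw [injective_iff_map_eq_zero]
    intro d hd
    exact hQ0 d ((hφ0 _).1 hd)
  let ι : FractionRing D →+* L := IsFractionRing.lift hinj
  have hι : ∀ d, ι (algebraMap D _ d) = φ (MvPolynomial.C d) := fun d =>
    IsFractionRing.lift_algebraMap hinj d
  have halg : ∀ (u : FractionRing D) (v : V), (v : L) = ι u → ρ v ∈ F := by
    intro u v huv
    obtain ⟨g, ⟨n, hn⟩, hg⟩ := H u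
    refine ⟨g.map q, ?_, ?_⟩
    · intro h
      apply hn
      rw [← hq0, ← Polynomial.coeff_map, h, Polynomial.coeff_zero]
    · have h1 : g.eval₂ (ψ.comp MvPolynomial.C) v = 0 := by
        apply Subtype.ext
        change V.subtype _ = 0
        rw [Polynomial.hom_eval₂]
        have := congr(ι $hg)
        rw [Polynomial.aeval_def, Polynomial.hom_eval₂, map_zero] at this
        rw [← this]
        congr 1
        ext d
        simp [hι, hψ]
      have h2 := congr(ρ $h1)
      rw [Polynomial.hom_eval₂, map_zero] at h2
      rw [Polynomial.aeval_def, Polynomial.eval₂_map, ← h2]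
      rfl
  by_contra hne
  obtain ⟨f, hfQ, hf⟩ := Submodule.exists_mem_ne_zero_of_ne_bot hne
  obtain ⟨m, hm, hmax⟩ := Finset.exists_max_image f.support
    (fun m => V.valuation (φ (MvPolynomial.C (f.coeff m)))) (MvPolynomial.support_nonempty.2 hf)
  have hc : φ (MvPolynomial.C (f.coeff m)) ≠ 0 := by
    intro h
    exact (MvPolynomial.mem_support_iff.1 hm) (hQ0 _ ((hφ0 _).1 h))
  have hv : ∀ k, φ (MvPolynomial.C (f.coeff k)) / φ (MvPolynomial.C (f.coeff m)) ∈ V := by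
    intro k
    rw [← ValuationSubring.valuation_le_one_iff, map_div₀]
    by_cases hk : k ∈ f.support
    · exact div_le_one_of_le₀ (hmax k hk) zero_le
    · rw [MvPolynomial.notMem_support_iff] at hk
      simp [hk]
  let w : (σ →₀ ℕ) → V := fun k => ⟨_, hv k⟩
  have hw : ∀ k, ρ (w k) ∈ F := by
    intro k
    refine halg (algebraMap D _ (f.coeff k) / algebraMap D _ (f.coeff m)) (w k) ?_
    simp [w, hι]
  let G : MvPolynomial σ F := ∑ k ∈ f.support, MvPolynomial.monomial k ⟨ρ (w k), hw k⟩
  have hG : MvPolynomial.aeval x G = 0 := by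
    have h1 : ∑ k ∈ f.support, w k * ψ (MvPolynomial.monomial k 1) = 0 := by
      apply Subtype.ext
      change V.subtype _ = 0
      have h2 : φ f = 0 := (hφ0 f).2 hfQ
      rw [f.as_sum, map_sum] at h2
      rw [map_sum]
      rw [← mul_right_inj' hc, mul_zero, Finset.mul_sum, ← h2]
      apply Finset.sum_congr rfl
      intro k _
      have : MvPolynomial.monomial k (f.coeff k) =
        MvPolynomial.C (f.coeff k) * MvPolynomial.monomial k 1 := by
        rw [MvPolynomial.C_mul_monomial, mul_one]
      rw [this, map_mul, map_mul]
      simp only [ValuationSubring.subtype_apply, hψ, w]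
      field_simp
    have h3 := congr(ρ $h1)
    rw [map_sum, map_zero] at h3
    rw [map_sum, ← h3]
    apply Finset.sum_congr rfl
    intro k _
    rw [MvPolynomial.aeval_monomial, map_mul]
    congr 1
    rw [MvPolynomial.monomial_eq, MvPolynomial.C_1, one_mul]
    simp only [Finsupp.prod, map_prod, map_pow, x]
  have hG0 : G = 0 := (algebraicIndependent_iff.1 hind') G hG
  have h4 := congr(MvPolynomial.coeff m $hG0)
  simp only [G, MvPolynomial.coeff_sum, MvPolynomial.coeff_monomial, Finset.sum_ite_eq', hm, if_true,
    MvPolynomial.coeff_zero] at h4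
  have h5 : ρ (w m) = 0 := congr(($h4 : κ))
  have h6 : w m = 1 := Subtype.ext (div_self hc)
  rw [h6, map_one] at h5
  exact one_ne_zero h5

theorem sd_core {D σ : Type*} [CommRing D] [IsDomain D] (p : Ideal D) [p.IsPrime]
    (H : ∀ u : FractionRing D, ∃ g : D[X], (∃ n, g.coeff n ∉ p) ∧ aeval u g = 0)
    (Q : Ideal (MvPolynomial σ D)) [Q.IsPrime] (hQ : Q ≤ p.map MvPolynomial.C)
    (hP : (p.map (MvPolynomial.C : D →+* MvPolynomial σ D)).IsPrime)
    (hQ0 : ∀ d, MvPolynomial.C d ∈ Q → d = 0) : Q = ⊥ := by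
  let L := FractionRing (MvPolynomial σ D ⧸ Q)
  let φ : MvPolynomial σ D →+* L := (algebraMap (MvPolynomial σ D ⧸ Q) L).comp (Ideal.Quotient.mk Q)
  have hφ0 : ∀ r, φ r = 0 ↔ r ∈ Q := by
    intro r
    simp only [φ, RingHom.comp_apply]
    rw [FaithfulSMul.algebraMap_eq_zero_iff, Ideal.Quotient.eq_zero_iff_mem]
  obtain ⟨V, ψ, hψ, hres⟩ := sd_exists_val (p.map (MvPolynomial.C : D →+* MvPolynomial σ D)) φ
    (fun r hr => hQ ((hφ0 r).1 hr))
  exact sd_core_aux p H Q hQ0 φ hφ0 V ψ hψ _ hres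

theorem sd_idealHeight_eq {R : Type*} [CommRing R] (P : Ideal R) [hP : P.IsPrime] :
    idealHeight P = P.height := by
  have h := PrimeSpectrum.height_eq_orderHeight (⟨P, hP⟩ : PrimeSpectrum R)
  unfold idealHeight
  apply le_antisymm
  · refine (iInf₂_le (⟨P, hP⟩ : PrimeSpectrum R) (le_refl P)).trans h.symm.le
  · refine le_iInf₂ fun q hq => ?_
    rw [← PrimeSpectrum.height_eq_orderHeight]
    exact Ideal.height_mono hq

theorem sd_idealHeight_eq_one_iff {R : Type*} [CommRing R] [IsDomain R] (P : Ideal R)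
    [hP : P.IsPrime] :
    idealHeight P = 1 ↔ P ≠ ⊥ ∧ ∀ Q : Ideal R, Q.IsPrime → Q ≤ P → Q ≠ ⊥ → Q = P := by
  rw [sd_idealHeight_eq, le_antisymm_iff, and_comm, Order.one_le_iff_ne_zero, Ne,
    Ideal.height_eq_zero_iff_eq_bot]
  refine and_congr Iff.rfl ?_
  have := Ideal.height_le_iff (p := P) (n := 1)
  rw [Nat.cast_one] at this
  rw [this]
  refine forall_congr' fun Q => forall_congr' fun hQ => ?_
  rw [Order.lt_one_iff, Ideal.height_eq_zero_iff_eq_bot]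
  constructor
  · intro h h1 h2
    by_contra h3
    exact h2 (h (lt_of_le_of_ne h1 h3))
  · intro h h1
    by_contra h2
    exact h1.ne (h h1.le h2)

theorem sd_div {D : Type*} [CommRing D] [IsDomain D] (P : Ideal D[X]) (f : D[X]) (hf : f ∈ P)
    (hf0 : f ≠ 0) (hmin : ∀ g ∈ P, g ≠ 0 → f.natDegree ≤ g.natDegree)
    (hpos : 0 < f.natDegree) :
    ∀ (n : ℕ) (g : D[X]), g.natDegree ≤ n → g ∈ P → ∃ d : D, d ≠ 0 ∧ ∃ q, C d * g = f * q := by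
  intro n
  induction n with
  | zero =>
    intro g hg hgP
    by_cases h : g = 0
    · exact ⟨1, one_ne_zero, 0, by simp [h]⟩
    · have := hmin g hgP h
      omega
  | succ n ih =>
    intro g hg hgP
    by_cases h : g = 0
    · exact ⟨1, one_ne_zero, 0, by simp [h]⟩
    have h1 := hmin g hgP h
    have h2 := Polynomial.natDegree_cancelLeads_lt_of_natDegree_le_natDegree h1 (by omega)
    have h3 : f.cancelLeads g ∈ P :=
      P.sub_mem (P.mul_mem_left _ hgP) (P.mul_mem_left _ hf)
    obtain ⟨d, hd, q, hq⟩ := ih _ (by omega) h3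
    refine ⟨d * f.leadingCoeff, mul_ne_zero hd (by simpa using hf0),
      q + C d * C g.leadingCoeff * X ^ (g.natDegree - f.natDegree), ?_⟩
    rw [Polynomial.cancelLeads, Nat.sub_eq_zero_of_le h1, pow_zero] at hq
    rw [C_mul]
    linear_combination hq

theorem sd_caseA {D : Type*} [CommRing D] [IsDomain D] (P : Ideal D[X]) [P.IsPrime]
    (hP0 : P ≠ ⊥) (hPD : ∀ d, C d ∈ P → d = 0)
    (hP : ∀ Q : Ideal D[X], Q.IsPrime → Q ≤ P → Q ≠ ⊥ → Q = P)
    (Q : Ideal D[X][X]) (hQp : Q.IsPrime) (hQ : Q ≤ P.map C) (hQ0 : Q ≠ ⊥) : Q = P.map C := by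
  classical
  have hcom : Q.comap C ≤ P := by
    intro g hg
    have := Ideal.mem_map_C_iff.1 (hQ hg) 0
    simpa using this
  by_cases hc : Q.comap C = ⊥
  swap
  · have h := hP _ (Ideal.IsPrime.comap C) hcom hc
    exact le_antisymm hQ (Ideal.map_le_iff_le_comap.2 h.ge)
  exfalso
  obtain ⟨f0, hf0P, hf00⟩ := Submodule.exists_mem_ne_zero_of_ne_bot hP0
  obtain ⟨f, ⟨hfP, hf⟩, hmin⟩ := exists_minimalFor_of_wellFoundedLT
    (fun g : D[X] => g ∈ P ∧ g ≠ 0) natDegree ⟨f0, hf0P, hf00⟩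
  have hmin' : ∀ g ∈ P, g ≠ 0 → f.natDegree ≤ g.natDegree := by
    intro g h1 h2
    by_contra h3
    exact h3 (hmin ⟨h1, h2⟩ (by omega))
  have hpos : 0 < f.natDegree := by
    by_contra h
    have h1 := Polynomial.eq_C_of_natDegree_eq_zero (p := f) (by omega)
    rw [h1] at hfP
    rw [hPD _ hfP, C_0] at h1
    exact hf h1
  have hfQ : C f ∉ Q := by
    intro h
    have : f ∈ Q.comap C := h
    rw [hc] at this
    exact hf this
  have hdiv : ∀ h ∈ P.map (C : D[X] →+* D[X][X]), ∃ d : D, d ≠ 0 ∧ ∃ q, C (C d) * h = C f * q := by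
    intro h hh
    induction hh using Submodule.span_induction with
    | mem x hx =>
      obtain ⟨g, hg, rfl⟩ := hx
      obtain ⟨d, hd, q, hq⟩ := sd_div P f hfP hf hmin' hpos _ g le_rfl hg
      exact ⟨d, hd, C q, by rw [← C_mul, ← C_mul, hq]⟩
    | zero => exact ⟨1, one_ne_zero, 0, by simp⟩
    | add x y _ _ hx hy =>
      obtain ⟨d, hd, q, hq⟩ := hx
      obtain ⟨d', hd', q', hq'⟩ := hy
      refine ⟨d * d', mul_ne_zero hd hd', C (C d') * q + C (C d) * q', ?_⟩
      rw [C_mul, C_mul]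
      linear_combination C (C d') * hq + C (C d) * hq'
    | smul a x _ hx =>
      obtain ⟨d, hd, q, hq⟩ := hx
      refine ⟨d, hd, a * q, ?_⟩
      rw [smul_eq_mul]
      linear_combination a * hq
  obtain ⟨h0, hh0, hh00⟩ := Submodule.exists_mem_ne_zero_of_ne_bot hQ0
  obtain ⟨h, ⟨hhQ, hh⟩, hhmin⟩ := exists_minimalFor_of_wellFoundedLT
    (fun g : D[X][X] => g ∈ Q ∧ g ≠ 0) (fun g => g.leadingCoeff.natDegree) ⟨h0, hh0, hh00⟩
  obtain ⟨d, hd, q, hq⟩ := hdiv h (hQ hhQ)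
  have hq0 : q ≠ 0 := by
    rintro rfl
    rw [mul_zero] at hq
    simp [hd, hh] at hq
  have hqQ : q ∈ Q := by
    have : C f * q ∈ Q := hq ▸ Q.mul_mem_left _ hhQ
    exact (hQp.mem_or_mem this).resolve_left hfQ
  have hl := congr(($hq).leadingCoeff.natDegree)
  rw [leadingCoeff_mul, leadingCoeff_mul, leadingCoeff_C, leadingCoeff_C,
    natDegree_mul (by simpa using hd) (by simpa using hh),
    natDegree_mul hf (by simpa using hq0), natDegree_C] at hl
  have := hhmin (j := q) ⟨hqQ, hq0⟩ (by simp only; omega)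
  simp only at this
  omega

theorem sd_caseB {D : Type*} [CommRing D] [IsDomain D] (p : Ideal D) [p.IsPrime] (hp0 : p ≠ ⊥)
    (hP : ∀ Q : Ideal D[X], Q.IsPrime → Q ≤ p.map C → Q ≠ ⊥ → Q = p.map C)
    (Q : Ideal D[X][X]) (hQp : Q.IsPrime) (hQ : Q ≤ (p.map C).map C) (hQ0 : Q ≠ ⊥) :
    Q = (p.map C).map C := by
  obtain ⟨a, ha, ha0⟩ := Submodule.exists_mem_ne_zero_of_ne_bot hp0
  by_cases hc : Q.comap C = ⊥
  swap
  · have hcom : Q.comap C ≤ p.map C := by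
      intro g hg
      have := Ideal.mem_map_C_iff.1 (hQ hg) 0
      simpa using this
    have h := hP _ (Ideal.IsPrime.comap C) hcom hc
    exact le_antisymm hQ (Ideal.map_le_iff_le_comap.2 h.ge)
  exfalso
  apply hQ0
  let e : D[X][X] ≃+* MvPolynomial (Fin 2) D := (Polynomial.Bivariate.equivMvPolynomial D).toRingEquiv
  have he : ((p.map C).map C).map (e : D[X][X] →+* MvPolynomial (Fin 2) D) =
      p.map MvPolynomial.C := by
    rw [Ideal.map_map, Ideal.map_map]
    congr 1
    ext1 d
    exact Polynomial.Bivariate.equivMvPolynomial_C_C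
  have hprime : (Q.map (e : D[X][X] →+* MvPolynomial (Fin 2) D)).IsPrime :=
    Ideal.map_isPrime_of_equiv e
  have hpp : (p.map (MvPolynomial.C : D →+* MvPolynomial (Fin 2) D)).IsPrime := by
    rw [← he]
    exact Ideal.map_isPrime_of_equiv e
  have key := sd_core p ?_ (Q.map (e : D[X][X] →+* MvPolynomial (Fin 2) D))
    (he ▸ Ideal.map_mono hQ) hpp ?_
  · exact (Ideal.map_eq_bot_iff_of_injective
      (f := (e : D[X][X] →+* MvPolynomial (Fin 2) D)) e.injective).1 key
  · intro u
    by_contra hcon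
    push Not at hcon
    have hk : RingHom.ker (aeval u : D[X] →ₐ[D] FractionRing D) = p.map C := by
      apply hP _ (RingHom.ker_isPrime _)
      · intro g hg
        rw [Ideal.mem_map_C_iff]
        intro n
        by_contra hn
        exact hcon g ⟨n, hn⟩ hg
      · obtain ⟨x, y, hy, rfl⟩ := IsFractionRing.div_surjective (A := D) u
        intro hbot
        have hy0 : y ≠ 0 := nonZeroDivisors.ne_zero hy
        have hyK : algebraMap D (FractionRing D) y ≠ 0 := by simpa using hy0
        have hm : C y * X - C x ∈ RingHom.ker
            (aeval (algebraMap D (FractionRing D) x / algebraMap D (FractionRing D) y) :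
              D[X] →ₐ[D] FractionRing D) := by
          rw [RingHom.mem_ker]
          simp
          field_simp
          simp
        rw [hbot, Ideal.mem_bot] at hm
        have := congr(($hm).coeff 1)
        simp [coeff_C] at this
        exact hy0 this
    have ha' : C a ∈ RingHom.ker (aeval u : D[X] →ₐ[D] FractionRing D) :=
      hk ▸ Ideal.mem_map_of_mem C ha
    rw [RingHom.mem_ker] at ha'
    simp at ha'
    exact ha0 ha'
  · intro d hd
    rw [← Polynomial.Bivariate.equivMvPolynomial_C_C] at hd
    have h1 : C (C d) ∈ Q := by
      rw [← Ideal.comap_map_of_bijective (e : D[X][X] →+* MvPolynomial (Fin 2) D) e.bijective (I := Q)]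
      exact hd
    have h2 : C d ∈ Q.comap C := h1
    rw [hc, Ideal.mem_bot, C_eq_zero] at h2
    exact h2

/-- for any integral domain `D`, the polynomial ring `D[X]` is an S-domain. -/
theorem stmt9 {D : Type*} [CommRing D] [IsDomain D] : IsSDomain (Polynomial D) := by
  intro P hPp hP
  rw [sd_idealHeight_eq_one_iff] at hP ⊢
  obtain ⟨hP0, hP⟩ := hP
  refine ⟨?_, ?_⟩
  · rwa [Ne, Ideal.map_eq_bot_iff_of_injective C_injective]
  by_cases hc : P.comap C = ⊥
  · refine sd_caseA P hP0 ?_ hP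
    intro d hd
    have : d ∈ P.comap C := hd
    rwa [hc] at this
  · have hpr : (P.comap C).IsPrime := Ideal.IsPrime.comap C
    have h := hP ((P.comap C).map C) inferInstance Ideal.map_comap_le
      (by rwa [Ne, Ideal.map_eq_bot_iff_of_injective C_injective])
    have := sd_caseB (P.comap C) hc (by rw [h]; exact hP)
    rw [h] at this
    exact this
end

section
/- For an integral domain D, the following are equivalent: (a) D is an S-domain; (b) for every prime ideal P of D of height 1, the localization D_P is an S-domain. -/
open Polynomial

theorem idealHeight_eq_of_isPrime {R : Type*} [CommRing R] (I : Ideal R) [hI : I.IsPrime] :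
    idealHeight I = I.height := by
  have h := PrimeSpectrum.height_eq_orderHeight (⟨I, hI⟩ : PrimeSpectrum R)
  change I.height = _ at h
  rw [h]
  unfold idealHeight
  apply le_antisymm
  · exact iInf₂_le (⟨I, hI⟩ : PrimeSpectrum R) (le_refl I)
  · refine le_iInf₂ fun P hP => Order.height_mono ?_
    exact hP

theorem idealHeight_under {R : Type*} [CommRing R] (M : Submonoid R) {A : Type*} [CommRing A]
    [Algebra R A] [IsLocalization M A] (Q : Ideal A) [Q.IsPrime] :
    idealHeight (Q.under R) = idealHeight Q := by
  rw [idealHeight_eq_of_isPrime, idealHeight_eq_of_isPrime, IsLocalization.height_under M]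

theorem idealHeight_under_map {R : Type*} [CommRing R] (M : Submonoid R) {A : Type*} [CommRing A]
    [Algebra R A] [IsLocalization M A] (Q : Ideal A) [hQ : Q.IsPrime] :
    idealHeight ((Q.under R).map (C : R →+* R[X])) = idealHeight (Q.map (C : A →+* A[X])) := by
  letI : Algebra R[X] A[X] := Polynomial.algebra R A
  haveI : IsLocalization (M.map (C : R →+* R[X])) A[X] := Polynomial.isLocalization M A
  have h1 : ((Q.under R).map (C : R →+* R[X])).IsPrime :=
    Ideal.isPrime_map_C_of_isPrime
  have h2 : (Q.map (C : A →+* A[X])).IsPrime := Ideal.isPrime_map_C_of_isPrime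
  rw [idealHeight_eq_of_isPrime, idealHeight_eq_of_isPrime]
  have e : Q.map (C : A →+* A[X]) =
      ((Q.under R).map (C : R →+* R[X])).map (algebraMap R[X] A[X]) := by
    conv_lhs => rw [← IsLocalization.map_under M A Q]
    rw [Ideal.map_map, Ideal.map_map]
    congr 1
    ext x
    simp [Polynomial.algebraMap_def]
  rw [e, IsLocalization.height_map_of_disjoint (M.map C)]
  refine Set.disjoint_left.mpr ?_
  rintro _ ⟨b, hb, rfl⟩ hm
  have hm' := (Ideal.mem_map_C_iff.mp hm) 0
  have hm'' : b ∈ Q.under R := by simpa using hm'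
  exact hQ.ne_top (Ideal.eq_top_of_isUnit_mem _ hm'' (IsLocalization.map_units A ⟨b, hb⟩))

/-- an integral domain `D` is an S-domain iff for every prime ideal `P`
of `D` of height 1, the localization `D_P` is an S-domain. -/
theorem stmt11 {D : Type*} [CommRing D] [IsDomain D] :
    IsSDomain D ↔
      ∀ (P : Ideal D) (hP : P.IsPrime), idealHeight P = 1 →
        IsSDomain (Localization (Ideal.primeCompl P (hp := hP))) := by
  constructor
  · intro h P hP _ Q hQ hQ1
    rw [← idealHeight_under_map P.primeCompl]
    exact h _ inferInstance (by rw [idealHeight_under P.primeCompl, hQ1])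
  · intro h P hP hP1
    let A := Localization P.primeCompl
    have hd : Disjoint (P.primeCompl : Set D) (P : Set D) :=
      Set.disjoint_left.mpr fun _ a b => a b
    have hQ : (P.map (algebraMap D A)).IsPrime :=
      IsLocalization.isPrime_of_isPrime_disjoint P.primeCompl A P hP hd
    have hu : (P.map (algebraMap D A)).under D = P :=
      IsLocalization.under_map_of_isPrime_disjoint P.primeCompl A hP hd
    have := h P hP hP1 (P.map (algebraMap D A)) hQ
      (by rw [← idealHeight_under P.primeCompl, hu, hP1])
    rwa [← idealHeight_under_map P.primeCompl, hu] at this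
end
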